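/- Let 0<q<1 and a,b ∈ ℝ, and let x ≥ 0. Then \int_0^x e^{-t} R(a,b,q,t)\,dt = 1 - e^{-x} R(a,b,q,x) + \sum_{n=1}^\infty \left( \prod_{j=0}^{n-1}(a+bq^j) \right) \frac{x^n}{n!} \, M(n, n+1, -x), where M(n, n+1, -x) = \sum_{k=0}^\infty \frac{n}{n+k} \frac{(-x)^k}{k!} is Kummer's confluent hypergeometric function {}_1F_1(n; n+1; -x), and all series converge absolutely. -/

import Mathlib

open Finset

/-- The Ramanujan function `R(a,b,q,x) = 1 + ∑_{n≥1} (xⁿ/n!) ∏_{j=0}^{n-1} (a + b qʲ)`,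
written as a single `tsum` (the `n = 0` term equals `1`). -/
noncomputable def ramanujanR (a b q x : ℝ) : ℝ :=
  ∑' n : ℕ, x ^ n / (Nat.factorial n : ℝ) * ∏ j ∈ Finset.range n, (a + b * q ^ j)

/-- Kummer's confluent hypergeometric function `₁F₁(n; n+1; z) = ∑_{k≥0} (n/(n+k)) zᵏ/k!`. -/
noncomputable def kummerM (n : ℕ) (z : ℝ) : ℝ :=
  ∑' k : ℕ, (n : ℝ) / ((n : ℝ) + (k : ℝ)) * z ^ k / (Nat.factorial k : ℝ)

/-- Termwise integration on `[0, x]` of a continuous function times a power series. -/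
theorem hasSum_mul_integral_mul_pow {d : ℕ → ℝ} {g : ℝ → ℝ} (hg : Continuous g) {x : ℝ}
    (hx : 0 ≤ x) (hd : Summable fun n => |d n| * x ^ n) :
    HasSum (fun n => d n * ∫ t in (0:ℝ)..x, g t * t ^ n)
      (∫ t in (0:ℝ)..x, g t * ∑' n, d n * t ^ n) := by
  have hle : ∀ n, ∀ t ∈ Set.uIoc 0 x, ‖d n * t ^ n‖ ≤ |d n| * x ^ n := by
    intro n t ht
    rw [Set.uIoc_of_le hx] at ht
    rw [Real.norm_eq_abs, abs_mul, abs_pow, abs_of_pos ht.1]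
    exact mul_le_mul_of_nonneg_left (pow_le_pow_left₀ ht.1.le ht.2 n) (abs_nonneg _)
  have key : HasSum (fun n => ∫ t in (0:ℝ)..x, g t * (d n * t ^ n))
      (∫ t in (0:ℝ)..x, g t * ∑' n, d n * t ^ n) := by
    refine intervalIntegral.hasSum_integral_of_dominated_convergence
      (fun n t => |g t| * (|d n| * x ^ n)) ?_ ?_ ?_ ?_ ?_
    · intro n
      exact Continuous.aestronglyMeasurable (by fun_prop)
    · intro n
      filter_upwards with t ht
      rw [norm_mul, Real.norm_eq_abs (g t)]
      exact mul_le_mul_of_nonneg_left (hle n t ht) (abs_nonneg _)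
    · filter_upwards with t _
      exact hd.mul_left _
    · simp only [tsum_mul_left]
      exact Continuous.intervalIntegrable (by fun_prop) _ _
    · filter_upwards with t ht
      exact (Summable.of_norm_bounded hd fun n => hle n t ht).hasSum.mul_left _
  convert key using 2 with n
  rw [← intervalIntegral.integral_const_mul]
  congr 1 with t
  ring

theorem abs_prod_add_mul_pow_le {q : ℝ} (hq0 : 0 ≤ q) (hq1 : q ≤ 1) (a b : ℝ) (n : ℕ) :
    |∏ j ∈ Finset.range n, (a + b * q ^ j)| ≤ (|a| + |b|) ^ n := by
  rw [Finset.abs_prod]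
  calc _ ≤ ∏ _j ∈ Finset.range n, (|a| + |b|) := by
        refine Finset.prod_le_prod (fun _ _ => abs_nonneg _) fun j _ => ?_
        refine (abs_add_le _ _).trans (add_le_add_right ?_ _)
        rw [abs_mul, abs_of_nonneg (pow_nonneg hq0 j)]
        exact mul_le_of_le_one_right (abs_nonneg _) (pow_le_one₀ hq0 hq1)
    _ = _ := by simp

theorem summable_abs_ramanujanR_coeff {q : ℝ} (hq0 : 0 ≤ q) (hq1 : q ≤ 1) (a b : ℝ) {x : ℝ}
    (hx : 0 ≤ x) :
    Summable fun n : ℕ =>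
      |(∏ j ∈ Finset.range n, (a + b * q ^ j)) / (Nat.factorial n : ℝ)| * x ^ n := by
  refine Summable.of_nonneg_of_le (fun n => by positivity) (fun n => ?_)
    (Real.summable_pow_div_factorial ((|a| + |b|) * x))
  rw [abs_div, Nat.abs_cast, mul_pow, div_mul_eq_mul_div]
  gcongr
  exact abs_prod_add_mul_pow_le hq0 hq1 a b n

theorem ramanujanR_eq_tsum (a b q x : ℝ) :
    ramanujanR a b q x =
      ∑' n : ℕ, (∏ j ∈ Finset.range n, (a + b * q ^ j)) / (Nat.factorial n : ℝ) * x ^ n :=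
  tsum_congr fun n => by ring

/-- Euler's integral for `₁F₁(n+1; n+2; -x)`. -/
theorem pow_succ_mul_kummerM_neg (n : ℕ) {x : ℝ} (hx : 0 ≤ x) :
    x ^ (n + 1) * kummerM (n + 1) (-x) =
      (n + 1) * ∫ t in (0:ℝ)..x, Real.exp (-t) * t ^ n := by
  have h := hasSum_mul_integral_mul_pow (d := fun k => (-1) ^ k / (Nat.factorial k : ℝ))
    (g := fun t => t ^ n) (by fun_prop) hx (by
      refine (Real.summable_pow_div_factorial x).congr fun k => ?_
      rw [abs_div, abs_pow, abs_neg, abs_one, one_pow, Nat.abs_cast]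
      ring)
  have hexp : ∀ t : ℝ, ∑' k : ℕ, (-1) ^ k / (Nat.factorial k : ℝ) * t ^ k = Real.exp (-t) := by
    intro t
    rw [Real.exp_eq_exp_ℝ, NormedSpace.exp_eq_tsum_div]
    refine tsum_congr fun k => ?_
    rw [neg_pow t]
    ring
  simp only [hexp, mul_comm (_ ^ n) (Real.exp _)] at h
  rw [← h.tsum_eq, kummerM, ← tsum_mul_left, ← tsum_mul_left]
  refine tsum_congr fun k => ?_
  simp only [← pow_add, integral_pow]
  rw [neg_pow x]
  have h1 : (n : ℝ) + k + 1 ≠ 0 := by positivity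
  have h2 : (n : ℝ) + 1 + k ≠ 0 := by positivity
  have h3 : (Nat.factorial k : ℝ) ≠ 0 := by positivity
  push_cast
  field_simp
  ring

theorem integral_exp_neg_mul_pow_succ (n : ℕ) (x : ℝ) :
    ∫ t in (0:ℝ)..x, Real.exp (-t) * t ^ (n + 1) =
      (n + 1) * (∫ t in (0:ℝ)..x, Real.exp (-t) * t ^ n) - Real.exp (-x) * x ^ (n + 1) := by
  have h : ∫ t in (0:ℝ)..x,
      ((n + 1) * (Real.exp (-t) * t ^ n) - Real.exp (-t) * t ^ (n + 1)) =
        Real.exp (-x) * x ^ (n + 1) - Real.exp (-0) * 0 ^ (n + 1) := by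
    refine intervalIntegral.integral_eq_sub_of_hasDerivAt
      (f := fun t => Real.exp (-t) * t ^ (n + 1)) (fun t _ => ?_)
      (Continuous.intervalIntegrable (by fun_prop) _ _)
    refine ((hasDerivAt_neg t).exp.mul (hasDerivAt_pow (n + 1) t)).congr_deriv ?_
    push_cast
    ring
  rw [intervalIntegral.integral_sub (Continuous.intervalIntegrable (by fun_prop) _ _)
    (Continuous.intervalIntegrable (by fun_prop) _ _),
    intervalIntegral.integral_const_mul] at h
  simp only [ne_eq, Nat.add_eq_zero_iff, one_ne_zero, and_false, not_false_eq_true, zero_pow,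
    mul_zero, sub_zero] at h
  linarith

/-- For `x ≥ 0`,
`∫_0^x e^{-t} R(a,b,q,t) dt
  = 1 - e^{-x} R(a,b,q,x) + ∑_{n≥1} (∏_{j=0}^{n-1}(a+bqʲ)) (xⁿ/n!) ₁F₁(n; n+1; -x)`,
where all the series converge absolutely (the outer series being indexed below by `n+1`). -/
theorem stmt_9 (q a b : ℝ) (hq0 : 0 < q) (hq1 : q < 1) (x : ℝ) (hx : 0 ≤ x) :
    (∀ n : ℕ, Summable (fun k : ℕ =>
      |((n : ℝ) + 1) / (((n : ℝ) + 1) + (k : ℝ)) * (-x) ^ k / (Nat.factorial k : ℝ)|)) ∧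
    Summable (fun n : ℕ =>
      |(∏ j ∈ Finset.range (n + 1), (a + b * q ^ j)) *
        (x ^ (n + 1) / (Nat.factorial (n + 1) : ℝ)) * kummerM (n + 1) (-x)|) ∧
    ∫ t in (0:ℝ)..x, Real.exp (-t) * ramanujanR a b q t =
      1 - Real.exp (-x) * ramanujanR a b q x +
        ∑' n : ℕ,
          (∏ j ∈ Finset.range (n + 1), (a + b * q ^ j)) *
            (x ^ (n + 1) / (Nat.factorial (n + 1) : ℝ)) * kummerM (n + 1) (-x) := by
  set c : ℕ → ℝ := fun n => (∏ j ∈ Finset.range n, (a + b * q ^ j)) / (Nat.factorial n : ℝ)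
    with hc
  have hsum := summable_abs_ramanujanR_coeff hq0.le hq1.le a b hx
  have hint := hasSum_mul_integral_mul_pow (g := fun t => Real.exp (-t)) (by fun_prop) hx hsum
  simp only [← ramanujanR_eq_tsum] at hint
  have hR : HasSum (fun n => c n * x ^ n) (ramanujanR a b q x) := by
    rw [ramanujanR_eq_tsum]
    refine (Summable.of_norm (hsum.congr fun n => ?_)).hasSum
    rw [Real.norm_eq_abs, abs_mul, abs_pow, abs_of_nonneg hx]
  have key := (hasSum_nat_add_iff' 1).mpr (hint.add (hR.mul_left (Real.exp (-x))))
  have key' : HasSum (fun n : ℕ => (∏ j ∈ Finset.range (n + 1), (a + b * q ^ j)) *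
      (x ^ (n + 1) / (Nat.factorial (n + 1) : ℝ)) * kummerM (n + 1) (-x))
      ((∫ t in (0:ℝ)..x, Real.exp (-t) * ramanujanR a b q t) +
        Real.exp (-x) * ramanujanR a b q x - 1) := by
    rw [Finset.sum_range_one] at key
    have h0 : (∏ j ∈ Finset.range 0, (a + b * q ^ j)) / (Nat.factorial 0 : ℝ) *
        (∫ t in (0:ℝ)..x, Real.exp (-t) * t ^ 0) + Real.exp (-x) * (c 0 * x ^ 0) = 1 := by
      simp [hc]
    rw [h0] at key
    refine Eq.subst (motive := fun f => HasSum f _) (funext fun n => ?_) key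
    rw [integral_exp_neg_mul_pow_succ, ← pow_succ_mul_kummerM_neg n hx]
    simp only [hc]
    ring
  refine ⟨fun n => ?_, key'.summable.abs, ?_⟩
  · refine Summable.of_nonneg_of_le (fun k => abs_nonneg _) (fun k => ?_)
      (Real.summable_pow_div_factorial x)
    rw [abs_div, abs_mul, abs_pow, abs_neg, Nat.abs_cast, abs_of_nonneg hx,
      abs_of_nonneg (by positivity)]
    gcongr
    refine mul_le_of_le_one_left (by positivity) ?_
    rw [div_le_one (by positivity)]
    linarith [Nat.cast_nonneg (α := ℝ) k]
  · rw [key'.tsum_eq]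
    ring
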